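/- Let n ≥ 2 and let p, p' : Fin n → Fin 2 satisfy w(p) = w(p') and d(p, p') = 2 (so p and p' are adjacent vertices of the diagonal induced graph of K_n). Then the set {r : Fin n → Fin 2 | w(r) = w(p) ∧ d(r, p) = 2 ∧ d(r, p') = 2} of their common neighbors has cardinality exactly n − 2. -/

import Mathlib

/-- The state space of an `n`-qubit register under the standard computational basis. -/
abbrev Qn (n : ℕ) := Fin n → Fin 2

/-- The weight of `q : Fin n → Fin 2`: the number of indices where `q` equals `1`. -/
noncomputable def weight {n : ℕ} (q : Qn n) : ℕ := {i : Fin n | q i = 1}.ncard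

/-- The Hamming distance between `p q : Fin n → Fin 2`. -/
noncomputable def hammingDist' {n : ℕ} (p q : Qn n) : ℕ := {i : Fin n | p i ≠ q i}.ncard

theorem weight_eq_and_hammingDist'_eq_two_iff {n : ℕ} (p q : Qn n) :
    weight p = weight q ∧ hammingDist' p q = 2 ↔
      ∃ j k, p j = 1 ∧ q j = 0 ∧ p k = 0 ∧ q k = 1 ∧ ∀ i, i ≠ j → i ≠ k → p i = q i := by
  have bit (x : Fin 2) : x = 0 ∨ x = 1 := by omega
  have hwt : weight p = weight q ↔
      ({i | p i = 1} \ {i | q i = 1}).ncard = ({i | q i = 1} \ {i | p i = 1}).ncard :=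
    Set.ncard_eq_ncard_iff_ncard_sdiff_eq_ncard_sdiff (Set.toFinite _) (Set.toFinite _)
  have hdist : hammingDist' p q =
      ({i | p i = 1} \ {i | q i = 1}).ncard + ({i | q i = 1} \ {i | p i = 1}).ncard := by
    rw [← Set.ncard_union_eq disjoint_sdiff_sdiff (Set.toFinite _) (Set.toFinite _), hammingDist']
    congr 1
    ext i
    rcases bit (p i) with h | h <;> rcases bit (q i) with h' | h' <;> simp [h, h']
  have hone : weight p = weight q ∧ hammingDist' p q = 2 ↔
      ({i | p i = 1} \ {i | q i = 1}).ncard = 1 ∧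
        ({i | q i = 1} \ {i | p i = 1}).ncard = 1 := by
    omega
  rw [hone, Set.ncard_eq_one, Set.ncard_eq_one, exists_and_exists_comm]
  refine exists_congr fun j => exists_congr fun k => ?_
  simp only [Set.ext_iff, Set.mem_sdiff, Set.mem_ofPred_eq, Set.mem_singleton_iff]
  grind

/-- The common neighbor, indexed by `c`, of two vertices that differ exactly at `a` and `b`. -/
def commonNeighbor {n : ℕ} (p : Qn n) (a b c : Fin n) : Qn n :=
  fun i => if i = c then (if p c = 0 then 1 else 0) else if i = a ∨ i = b then p c else p i

theorem commonNeighbor_injOn {n : ℕ} (p : Qn n) (a b : Fin n) :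
    Set.InjOn (commonNeighbor p a b) {a, b}ᶜ := by
  intro c hc d hd h
  have hc' := congrFun h c
  simp only [commonNeighbor, Set.mem_compl_iff, Set.mem_insert_iff, Set.mem_singleton_iff]
    at hc hd hc'
  grind

/-- two adjacent vertices of the diagonal induced graph of `K_n`
(i.e. `w(p) = w(p')` and `d(p, p') = 2`) have exactly `n - 2` common neighbors. -/
theorem diag_induced_common_neighbors (n : ℕ) (hn : 2 ≤ n) (p p' : Qn n)
    (hw : weight p = weight p') (hd : hammingDist' p p' = 2) :
    {r : Qn n | weight r = weight p ∧ hammingDist' r p = 2 ∧ hammingDist' r p' = 2}.ncard =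
      n - 2 := by
  have bit (x : Fin 2) : x = 0 ∨ x = 1 := by omega
  obtain ⟨a, b, hpa, hpa', hpb, hpb', hpp⟩ :=
    (weight_eq_and_hammingDist'_eq_two_iff p p').1 ⟨hw, hd⟩
  have hab : a ≠ b := by grind
  have himage : {r : Qn n | weight r = weight p ∧ hammingDist' r p = 2 ∧ hammingDist' r p' = 2} =
      commonNeighbor p a b '' {a, b}ᶜ := by
    ext r
    have hiff : (weight r = weight p ∧ hammingDist' r p = 2 ∧ hammingDist' r p' = 2) ↔
        (weight r = weight p ∧ hammingDist' r p = 2) ∧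
          (weight r = weight p' ∧ hammingDist' r p' = 2) := by
      rw [← hw]; tauto
    rw [Set.mem_ofPred_eq, hiff, weight_eq_and_hammingDist'_eq_two_iff,
      weight_eq_and_hammingDist'_eq_two_iff]
    simp only [Set.mem_image, Set.mem_compl_iff, Set.mem_insert_iff, Set.mem_singleton_iff, not_or]
    constructor
    · rintro ⟨⟨j, k, hj, hj', hk, hk', h⟩, ⟨l, m, hl, hl', hm, hm', h'⟩⟩
      by_cases hka : k = a
      · refine ⟨j, by grind, funext fun i => ?_⟩
        simp only [commonNeighbor]
        grind
      · refine ⟨k, by grind, funext fun i => ?_⟩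
        simp only [commonNeighbor]
        grind
    · rintro ⟨c, ⟨hca, hcb⟩, rfl⟩
      have hpc := hpp c hca hcb
      simp only [commonNeighbor]
      rcases bit (p c) with hc | hc
      · exact ⟨⟨c, a, by grind⟩, ⟨c, b, by grind⟩⟩
      · exact ⟨⟨b, c, by grind⟩, ⟨a, c, by grind⟩⟩
  rw [himage, (commonNeighbor_injOn p a b).ncard_image, Set.ncard_compl,
    Set.ncard_pair hab, Nat.card_fin]
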